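/- arXiv:2210.12368 — 3 statements merged into one kernel-verified Lean document; each statement's English description precedes it below -/
import Mathlib

section
/- (Propositions 1 and 2 combined.) Let P be a probability mass function on the finite product type α × β × γ, modeling the joint distribution of discrete random variables (Z_i, Z_j, C), with positivity P(a,b,c) > 0 for all a, b, c, and with Z_i and Z_j conditionally independent given C. Define the interventional distributions via the adjustment formula: q_i(a | b) = Σ_c P(Z_i = a | Z_j = b, C = c) · P(C = c) and q_j(b | a) = Σ_c P(Z_j = b | Z_i = a, C = c) · P(C = c). Let p(a,b) = Σ_c P(a,b,c) be the joint pmf of (Z_i, Z_j) with marginals p₁, p₂. Then the confounding measure I(Z_j → Z_i) + I(Z_i → Z_j) := Σ_{a,b} p(a,b) log( (p(a,b)/p₂(b)) / q_i(a|b) ) + Σ_{a,b} p(a,b) log( (p(a,b)/p₁(a)) / q_j(b|a) ) equals 2 · Σ_{a,b} p(a,b) log( p(a,b) / (p₁(a) p₂(b)) ), i.e., twice the mutual information I(Z_i; Z_j). -/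
/-- If `x / s = (u / s) * (v / s)` with nonzero denominators, then `(x / v) * s = u`. -/
lemma div_mul_eq_of_div_eq_div_mul_div {K : Type*} [Field K] {x s u v : K}
    (hs : s ≠ 0) (hv : v ≠ 0) (h : x / s = (u / s) * (v / s)) : x / v * s = u := by
  field_simp at h ⊢
  exact h

/-- Propositions 1 and 2 combined: under the collider structure
(conditional independence of `Z_i` and `Z_j` given `C`), the confounding
measure `I(Z_j → Z_i) + I(Z_i → Z_j)`, computed with the adjustment-formula
interventional distributions `q_i(a|b)` and `q_j(b|a)`, equals twice the
mutual information of `(Z_i, Z_j)`. -/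
theorem confounding_measure_collider_eq_twice_mutual_information
    {α β γ : Type*} [Fintype α] [Fintype β] [Fintype γ]
    [Nonempty α] [Nonempty β] [Nonempty γ]
    (P : α → β → γ → ℝ)
    (hpos : ∀ a b c, 0 < P a b c)
    (hsum : ∑ a, ∑ b, ∑ c, P a b c = 1)
    (hCI : ∀ a b c,
      P a b c / (∑ a', ∑ b', P a' b' c)
        = ((∑ b', P a b' c) / (∑ a', ∑ b', P a' b' c)) *
          ((∑ a', P a' b c) / (∑ a', ∑ b', P a' b' c)))
    (p : α → β → ℝ) (hp : ∀ a b, p a b = ∑ c, P a b c)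
    (qi : α → β → ℝ)
    (hqi : ∀ a b, qi a b
      = ∑ c, (P a b c / (∑ a', P a' b c)) * (∑ a', ∑ b', P a' b' c))
    (qj : β → α → ℝ)
    (hqj : ∀ b a, qj b a
      = ∑ c, (P a b c / (∑ b', P a b' c)) * (∑ a', ∑ b', P a' b' c)) :
    (∑ a, ∑ b, p a b *
        Real.log ((p a b / (∑ a', p a' b)) / qi a b))
      + (∑ a, ∑ b, p a b *
          Real.log ((p a b / (∑ b', p a b')) / qj b a))
      = 2 * ∑ a, ∑ b, p a b *
          Real.log (p a b / ((∑ b', p a b') * (∑ a', p a' b))) := by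
  have hβ (a : α) (c : γ) : 0 < ∑ b', P a b' c :=
    Finset.sum_pos (fun b _ => hpos a b c) Finset.univ_nonempty
  have hα (b : β) (c : γ) : 0 < ∑ a', P a' b c :=
    Finset.sum_pos (fun a _ => hpos a b c) Finset.univ_nonempty
  have hαβ (c : γ) : 0 < ∑ a', ∑ b', P a' b' c :=
    Finset.sum_pos (fun a _ => hβ a c) Finset.univ_nonempty
  have hqi_eq (a : α) (b : β) : qi a b = ∑ b', p a b' := by
    simp only [hqi, hp]
    rw [Finset.sum_comm]
    exact Finset.sum_congr rfl fun c _ =>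
      div_mul_eq_of_div_eq_div_mul_div (hαβ c).ne' (hα b c).ne' (hCI a b c)
  have hqj_eq (b : β) (a : α) : qj b a = ∑ a', p a' b := by
    simp only [hqj, hp]
    rw [Finset.sum_comm]
    exact Finset.sum_congr rfl fun c _ =>
      div_mul_eq_of_div_eq_div_mul_div (hαβ c).ne' (hβ a c).ne'
        ((hCI a b c).trans (mul_comm _ _))
  have hcomm (a : α) (b : β) :
      (∑ a', p a' b) * (∑ b', p a b') = (∑ b', p a b') * (∑ a', p a' b) := mul_comm _ _
  simp only [hqi_eq, hqj_eq, div_div, two_mul, hcomm]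
end

section
/- (Corollary of Propositions 1 and 2: under the collider generative structure, zero confounding measure is equivalent to independence of the generative factors.) Let P be a probability mass function on the finite product type α × β × γ with P(a,b,c) > 0 for all a, b, c, such that Z_i and Z_j are conditionally independent given C. Define q_i(a | b) = Σ_c P(Z_i = a | Z_j = b, C = c) · P(C = c) and q_j(b | a) = Σ_c P(Z_j = b | Z_i = a, C = c) · P(C = c), and let p(a,b) = Σ_c P(a,b,c) with marginals p₁, p₂. Then the confounding measure Σ_{a,b} p(a,b) log( (p(a,b)/p₂(b)) / q_i(a|b) ) + Σ_{a,b} p(a,b) log( (p(a,b)/p₁(a)) / q_j(b|a) ) equals 0 if and only if p(a,b) = p₁(a) · p₂(b) for all a, b. -/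
/-- Equality case of Gibbs' inequality. -/
lemma sum_mul_log_div_eq_zero_iff {ι : Type*} [Fintype ι] (p q : ι → ℝ)
    (hp : ∀ i, 0 < p i) (hq : ∀ i, 0 < q i) (h : ∑ i, p i = ∑ i, q i) :
    ∑ i, p i * Real.log (p i / q i) = 0 ↔ ∀ i, p i = q i := by
  have log_div_symm : ∀ i, Real.log (p i / q i) = -Real.log (q i / p i) := fun i => by
    rw [← Real.log_inv, inv_div]
  have mul_sub_one : ∀ i, p i * (q i / p i - 1) = q i - p i := fun i => by
    have := (hp i).ne'
    field_simp
  have sum_gap : ∑ i, p i * Real.log (p i / q i)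
      = ∑ i, (p i * Real.log (p i / q i) - (p i - q i)) := by
    rw [Finset.sum_sub_distrib, Finset.sum_sub_distrib, h]
    ring
  rw [sum_gap, Finset.sum_eq_zero_iff_of_nonneg]
  · refine ⟨fun H i => ?_, fun H i _ => ?_⟩
    · by_contra hne
      have hlt := mul_lt_mul_of_pos_left (Real.log_lt_sub_one_of_pos (div_pos (hq i) (hp i))
        (fun h1 => hne ((div_eq_one_iff_eq (hp i).ne').1 h1).symm)) (hp i)
      have hi := H i (Finset.mem_univ i)
      rw [mul_sub_one] at hlt
      rw [log_div_symm] at hi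
      linarith
    · rw [H i, div_self (hq i).ne']
      simp
  · intro i _
    have hle := mul_le_mul_of_nonneg_left
      (Real.log_le_sub_one_of_pos (div_pos (hq i) (hp i))) (hp i).le
    rw [mul_sub_one] at hle
    rw [log_div_symm]
    linarith


/-- corollary of Propositions 1 and 2: under the collider
generative structure (conditional independence of `Z_i` and `Z_j` given `C`),
the confounding measure computed with the adjustment-formula interventional
distributions vanishes iff the joint pmf of `(Z_i, Z_j)` factorizes as the
product of its marginals. -/
theorem confounding_measure_eq_zero_iff_independent
    {α β γ : Type*} [Fintype α] [Fintype β] [Fintype γ]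
    [Nonempty α] [Nonempty β] [Nonempty γ]
    (P : α → β → γ → ℝ)
    (hpos : ∀ a b c, 0 < P a b c)
    (hsum : ∑ a, ∑ b, ∑ c, P a b c = 1)
    (hCI : ∀ a b c,
      P a b c / (∑ a', ∑ b', P a' b' c)
        = ((∑ b', P a b' c) / (∑ a', ∑ b', P a' b' c)) *
          ((∑ a', P a' b c) / (∑ a', ∑ b', P a' b' c)))
    (p : α → β → ℝ) (hp : ∀ a b, p a b = ∑ c, P a b c)
    (qi : α → β → ℝ)
    (hqi : ∀ a b, qi a b
      = ∑ c, (P a b c / (∑ a', P a' b c)) * (∑ a', ∑ b', P a' b' c))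
    (qj : β → α → ℝ)
    (hqj : ∀ b a, qj b a
      = ∑ c, (P a b c / (∑ b', P a b' c)) * (∑ a', ∑ b', P a' b' c)) :
    ((∑ a, ∑ b, p a b *
        Real.log ((p a b / (∑ a', p a' b)) / qi a b))
      + (∑ a, ∑ b, p a b *
          Real.log ((p a b / (∑ b', p a b')) / qj b a))) = 0
      ↔ ∀ a b, p a b = (∑ b', p a b') * (∑ a', p a' b) := by
  have hC : ∀ c, 0 < ∑ a', ∑ b', P a' b' c := fun c =>
    Finset.sum_pos (fun a _ => Finset.sum_pos (fun b _ => hpos a b c) Finset.univ_nonempty)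
      Finset.univ_nonempty
  have hAC : ∀ a c, 0 < ∑ b', P a b' c := fun a c =>
    Finset.sum_pos (fun b _ => hpos a b c) Finset.univ_nonempty
  have hBC : ∀ b c, 0 < ∑ a', P a' b c := fun b c =>
    Finset.sum_pos (fun a _ => hpos a b c) Finset.univ_nonempty
  have hmul : ∀ a b c, P a b c * (∑ a', ∑ b', P a' b' c)
      = (∑ b', P a b' c) * (∑ a', P a' b c) := fun a b c => by
    have hCI' := hCI a b c
    have hC' := (hC c).ne'
    field_simp at hCI'
    linarith
  have qi_eq : ∀ a b, qi a b = ∑ b', p a b' := fun a b => by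
    simp_rw [hqi, hp]
    rw [Finset.sum_comm]
    refine Finset.sum_congr rfl fun c _ => ?_
    rw [div_mul_eq_mul_div, hmul, mul_div_cancel_right₀ _ (hBC b c).ne']
  have qj_eq : ∀ b a, qj b a = ∑ a', p a' b := fun b a => by
    simp_rw [hqj, hp]
    rw [Finset.sum_comm]
    refine Finset.sum_congr rfl fun c _ => ?_
    rw [div_mul_eq_mul_div, hmul, mul_div_cancel_left₀ _ (hAC a c).ne']
  have p_pos : ∀ a b, 0 < p a b := fun a b => by
    rw [hp]
    exact Finset.sum_pos (fun c _ => hpos a b c) Finset.univ_nonempty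
  have p_sum : ∑ a, ∑ b, p a b = 1 := by
    simp_rw [hp]
    exact hsum
  have gibbs := sum_mul_log_div_eq_zero_iff (fun x : α × β => p x.1 x.2)
    (fun x => (∑ b', p x.1 b') * (∑ a', p a' x.2)) (fun x => p_pos x.1 x.2)
    (fun x => mul_pos (Finset.sum_pos (fun b _ => p_pos x.1 b) Finset.univ_nonempty)
      (Finset.sum_pos (fun a _ => p_pos a x.2) Finset.univ_nonempty))
    (by
      simp_rw [Fintype.sum_prod_type]
      rw [← Finset.sum_mul_sum, p_sum, Finset.sum_comm (f := fun b a => p a b), p_sum, one_mul])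
  simp only [Fintype.sum_prod_type, Prod.forall] at gibbs
  rw [← gibbs]
  simp_rw [qi_eq, qj_eq, div_div]
  simp_rw [mul_comm (∑ a', p a' _) (∑ b', p _ b')]
  rw [add_self_eq_zero]
end

section
/- (Symmetry of the confounding measure under the collider structure.) Let P be a probability mass function on the finite product type α × β × γ with P(a,b,c) > 0 for all a, b, c, such that Z_i and Z_j are conditionally independent given C, and define the interventional distributions q_i(a | b) = Σ_c P(Z_i = a | Z_j = b, C = c) · P(C = c) and q_j(b | a) = Σ_c P(Z_j = b | Z_i = a, C = c) · P(C = c). Let p(a,b) = Σ_c P(a,b,c) with marginals p₁, p₂. Then the two directed informations are equal: Σ_{a,b} p(a,b) log( (p(a,b)/p₂(b)) / q_i(a|b) ) = Σ_{a,b} p(a,b) log( (p(a,b)/p₁(a)) / q_j(b|a) ), and each equals the mutual information Σ_{a,b} p(a,b) log( p(a,b) / (p₁(a) p₂(b)) ). -/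
/-- If `x / t = (m / t) * (n / t)` with `n, t ≠ 0`, then `x / n * t = m`. -/
lemma div_mul_eq_of_div_eq_mul_div {x m n t : ℝ} (hn : n ≠ 0) (ht : t ≠ 0)
    (h : x / t = m / t * (n / t)) : x / n * t = m := by
  field_simp at h ⊢
  linarith

/-- under the collider structure (conditional independence of
`Z_i` and `Z_j` given `C`), the two directed informations computed with the
adjustment-formula interventional distributions are equal, and each equals the
mutual information of `(Z_i, Z_j)`. -/
theorem directed_informations_symmetric_under_collider
    {α β γ : Type*} [Fintype α] [Fintype β] [Fintype γ]
    [Nonempty α] [Nonempty β] [Nonempty γ]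
    (P : α → β → γ → ℝ)
    (hpos : ∀ a b c, 0 < P a b c)
    (hsum : ∑ a, ∑ b, ∑ c, P a b c = 1)
    (hCI : ∀ a b c,
      P a b c / (∑ a', ∑ b', P a' b' c)
        = ((∑ b', P a b' c) / (∑ a', ∑ b', P a' b' c)) *
          ((∑ a', P a' b c) / (∑ a', ∑ b', P a' b' c)))
    (p : α → β → ℝ) (hp : ∀ a b, p a b = ∑ c, P a b c)
    (qi : α → β → ℝ)
    (hqi : ∀ a b, qi a b
      = ∑ c, (P a b c / (∑ a', P a' b c)) * (∑ a', ∑ b', P a' b' c))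
    (qj : β → α → ℝ)
    (hqj : ∀ b a, qj b a
      = ∑ c, (P a b c / (∑ b', P a b' c)) * (∑ a', ∑ b', P a' b' c)) :
    ((∑ a, ∑ b, p a b *
        Real.log ((p a b / (∑ a', p a' b)) / qi a b))
      = (∑ a, ∑ b, p a b *
          Real.log ((p a b / (∑ b', p a b')) / qj b a)))
    ∧ ((∑ a, ∑ b, p a b *
        Real.log ((p a b / (∑ a', p a' b)) / qi a b))
      = ∑ a, ∑ b, p a b *
          Real.log (p a b / ((∑ b', p a b') * (∑ a', p a' b)))) := by
  have hm (a c) : 0 < ∑ b', P a b' c :=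
    Finset.sum_pos (fun b _ => hpos a b c) Finset.univ_nonempty
  have hn (b c) : 0 < ∑ a', P a' b c :=
    Finset.sum_pos (fun a _ => hpos a b c) Finset.univ_nonempty
  have ht (c) : 0 < ∑ a', ∑ b', P a' b' c :=
    Finset.sum_pos (fun a _ => hm a c) Finset.univ_nonempty
  have hqi' (a b) : qi a b = ∑ b', p a b' := by
    simp_rw [hqi, hp]
    rw [Finset.sum_comm]
    exact Finset.sum_congr rfl fun c _ =>
      div_mul_eq_of_div_eq_mul_div (hn b c).ne' (ht c).ne' (hCI a b c)
  have hqj' (b a) : qj b a = ∑ a', p a' b := by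
    simp_rw [hqj, hp]
    rw [Finset.sum_comm]
    exact Finset.sum_congr rfl fun c _ =>
      div_mul_eq_of_div_eq_mul_div (hm a c).ne' (ht c).ne' ((hCI a b c).trans (mul_comm _ _))
  simp_rw [hqi', hqj', div_div]
  constructor <;> simp only [mul_comm (∑ a', p a' _)]
end
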